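/- Let n ≥ 1, 0 ≤ q < n/2, and s > q − n/2. There exists a constant C > 0 such that for every t ≥ 0 and every measurable function f : ℝⁿ → ℂ one has ( ∫_{ℝⁿ} |ξ|^{2s} |∂_t K̂(t,ξ)|² |f(ξ)|² dξ )^{1/2} ≤ C (1+t)^{−n/4 − (s−q)/2 − 1} [ ( ∫_{ℝⁿ} ⟨ξ⟩^{2s} |f(ξ)|² dξ )^{1/2} + sup_{ξ ∈ ℝⁿ} |ξ|^q |f(ξ)| ], where ∂_t K̂(t,ξ) denotes the derivative of K̂ in the time variable. -/

import Mathlib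

open MeasureTheory Real FourierTransform Filter
open scoped ENNReal

noncomputable section

abbrev Rn (n : ℕ) : Type := EuclideanSpace ℝ (Fin n)

/-- Fourier image of the damped wave kernel. -/
def Khat {n : ℕ} (t : ℝ) (ξ : Rn n) : ℝ :=
  if ‖ξ‖ < 1/2 then
    Real.exp (-t/2) * Real.sinh (t * Real.sqrt (1/4 - ‖ξ‖^2)) / Real.sqrt (1/4 - ‖ξ‖^2)
  else if ‖ξ‖ = 1/2 then t * Real.exp (-t/2)
  else Real.exp (-t/2) * Real.sin (t * Real.sqrt (‖ξ‖^2 - 1/4)) / Real.sqrt (‖ξ‖^2 - 1/4)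

/-- Time derivative of the kernel. -/
def KhatDt {n : ℕ} (t : ℝ) (ξ : Rn n) : ℝ := deriv (fun s => Khat s ξ) t

/-- Riesz potential `I_γ`. -/
def riesz (n : ℕ) (γ : ℝ) (f : Rn n → ℝ) : Rn n → ℝ :=
  if γ = 0 then f
  else fun x =>
    (Real.Gamma (((n : ℝ) - γ)/2) / (2 ^ γ * Real.pi ^ ((n : ℝ)/2) * Real.Gamma (γ/2))) *
      ∫ y : Rn n, f y * ‖x - y‖ ^ (-((n : ℝ) - γ))

/-- `g` represents the Fourier transform of `f` in the tempered-distribution sense. -/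
def HasFourier {n : ℕ} (f g : Rn n → ℂ) : Prop :=
  ∀ ψ : SchwartzMap (Rn n) ℂ,
    ∫ x : Rn n, f x * 𝓕 (fun y => ψ y) x = ∫ ξ : Rn n, g ξ * ψ ξ

/-- The Laplacian (sum of repeated coordinate second derivatives). -/
def lap {n : ℕ} (f : Rn n → ℝ) (x : Rn n) : ℝ :=
  ∑ i : Fin n,
    fderiv ℝ (fun y => fderiv ℝ f y (EuclideanSpace.single i 1)) x (EuclideanSpace.single i 1)

theorem sinh_le_self_mul_exp (x : ℝ) : Real.sinh x ≤ x * Real.exp x := by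
  have h1 := Real.add_one_le_exp (-(2 * x))
  have h2 : Real.exp (-x) = Real.exp (-(2 * x)) * Real.exp x := by
    rw [← Real.exp_add]; ring_nf
  rw [Real.sinh_eq, h2]
  nlinarith [Real.exp_pos x]

theorem cosh_le_exp {x : ℝ} (hx : 0 ≤ x) : Real.cosh x ≤ Real.exp x := by
  rw [Real.cosh_eq]
  linarith [Real.exp_le_exp.2 (by linarith : -x ≤ x)]

theorem hasDerivAt_exp_neg_half (t : ℝ) :
    HasDerivAt (fun s : ℝ => Real.exp (-s/2)) (-Real.exp (-t/2) / 2) t := by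
  have h : HasDerivAt (fun s : ℝ => -s/2) (-1/2) t := ((hasDerivAt_id t).neg).div_const 2
  convert h.exp using 1
  ring

theorem khatDt_of_norm_lt {n : ℕ} (t : ℝ) {ξ : Rn n} (h : ‖ξ‖ < 1/2) :
    KhatDt t ξ = Real.exp (-t/2) * (Real.cosh (t * √(1/4 - ‖ξ‖^2))
      - Real.sinh (t * √(1/4 - ‖ξ‖^2)) / (2 * √(1/4 - ‖ξ‖^2))) := by
  have hω : 0 < √(1/4 - ‖ξ‖^2) := Real.sqrt_pos.2 (by nlinarith [norm_nonneg ξ])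
  have hd := (((hasDerivAt_exp_neg_half t).mul
    ((hasDerivAt_mul_const (x := t) √(1/4 - ‖ξ‖^2)).sinh)).div_const √(1/4 - ‖ξ‖^2)).deriv
  simp only [KhatDt, Khat, if_pos h]
  refine hd.trans ?_
  generalize √(1/4 - ‖ξ‖^2) = ω at hω ⊢
  field_simp
  ring

theorem khatDt_of_norm_eq {n : ℕ} (t : ℝ) {ξ : Rn n} (h : ‖ξ‖ = 1/2) :
    KhatDt t ξ = Real.exp (-t/2) * (1 - t/2) := by
  have hd := ((hasDerivAt_id t).mul (hasDerivAt_exp_neg_half t)).deriv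
  simp only [KhatDt, Khat, h, lt_irrefl, if_false, if_true]
  refine hd.trans ?_
  simp only [id]
  ring

theorem khatDt_of_lt_norm {n : ℕ} (t : ℝ) {ξ : Rn n} (h : 1/2 < ‖ξ‖) :
    KhatDt t ξ = Real.exp (-t/2) * (Real.cos (t * √(‖ξ‖^2 - 1/4))
      - Real.sin (t * √(‖ξ‖^2 - 1/4)) / (2 * √(‖ξ‖^2 - 1/4))) := by
  have hω : 0 < √(‖ξ‖^2 - 1/4) := Real.sqrt_pos.2 (by nlinarith [norm_nonneg ξ])
  have hd := (((hasDerivAt_exp_neg_half t).mul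
    ((hasDerivAt_mul_const (x := t) √(‖ξ‖^2 - 1/4)).sin)).div_const √(‖ξ‖^2 - 1/4)).deriv
  simp only [KhatDt, Khat, if_neg h.not_gt, if_neg h.ne']
  refine hd.trans ?_
  generalize √(‖ξ‖^2 - 1/4) = ω at hω ⊢
  field_simp
  ring

theorem sqrt_quarter_sub_sq_le (r : ℝ) (hr : r ^ 2 ≤ 1/4) : √(1/4 - r^2) ≤ 1/2 - r^2 := by
  rw [Real.sqrt_le_left (by linarith)]
  nlinarith [sq_nonneg (r^2)]

/-- Away from the origin, the differentiated multiplier decays exponentially in time. -/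
theorem abs_khatDt_le_of_quarter_le {n : ℕ} {t : ℝ} (ht : 0 ≤ t) {ξ : Rn n} (h : 1/4 ≤ ‖ξ‖) :
    |KhatDt t ξ| ≤ (1 + t) * Real.exp (-(t / 16)) := by
  have he : Real.exp (-t/2) ≤ Real.exp (-(t / 16)) := Real.exp_le_exp.2 (by linarith)
  have hfar : ∀ y : ℝ, |y| ≤ 1 + t →
      |Real.exp (-t/2) * y| ≤ (1 + t) * Real.exp (-(t / 16)) := fun y hy => by
    rw [abs_mul, Real.abs_exp, mul_comm]
    exact mul_le_mul hy he (Real.exp_pos _).le (by linarith)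
  rcases lt_trichotomy ‖ξ‖ (1/2) with h2 | h2 | h2
  · rw [khatDt_of_norm_lt t h2]
    have hω : 0 < √(1/4 - ‖ξ‖^2) := Real.sqrt_pos.2 (by nlinarith)
    have hω' := sqrt_quarter_sub_sq_le ‖ξ‖ (by nlinarith)
    set ω := √(1/4 - ‖ξ‖^2)
    have hx : 0 ≤ t * ω := by positivity
    have hc := cosh_le_exp hx
    have hs : Real.sinh (t * ω) / (2 * ω) ≤ t * Real.exp (t * ω) := by
      rw [div_le_iff₀ (by positivity)]
      nlinarith [sinh_le_self_mul_exp (t * ω), mul_nonneg hx (Real.exp_pos (t * ω)).le]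
    have hs0 : 0 ≤ Real.sinh (t * ω) / (2 * ω) :=
      div_nonneg (Real.sinh_nonneg_iff.2 hx) (by positivity)
    have hb : |Real.cosh (t * ω) - Real.sinh (t * ω) / (2 * ω)| ≤ (1 + t) * Real.exp (t * ω) := by
      have := Real.cosh_pos (t * ω)
      have := mul_nonneg ht (Real.exp_pos (t * ω)).le
      rw [abs_le]; constructor <;> nlinarith
    rw [abs_mul, Real.abs_exp]
    calc Real.exp (-t/2) * |Real.cosh (t * ω) - Real.sinh (t * ω) / (2 * ω)|
        ≤ Real.exp (-t/2) * ((1 + t) * Real.exp (t * ω)) := by gcongr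
      _ = (1 + t) * Real.exp (-t/2 + t * ω) := by rw [Real.exp_add]; ring
      _ ≤ (1 + t) * Real.exp (-(t / 16)) := by
        gcongr
        nlinarith [mul_le_mul_of_nonneg_left (show ω ≤ 1/2 - 1/16 by nlinarith) ht]
  · rw [khatDt_of_norm_eq t h2]
    exact hfar _ (abs_le.2 ⟨by linarith, by linarith⟩)
  · rw [khatDt_of_lt_norm t h2]
    apply hfar
    have hω : 0 < √(‖ξ‖^2 - 1/4) := Real.sqrt_pos.2 (by nlinarith)
    set ω := √(‖ξ‖^2 - 1/4)
    have hs : |Real.sin (t * ω) / (2 * ω)| ≤ t := by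
      rw [abs_div, abs_of_pos (by positivity : 0 < 2 * ω), div_le_iff₀ (by positivity)]
      have := Real.abs_sin_le_abs (x := t * ω)
      rw [abs_of_nonneg (by positivity : 0 ≤ t * ω)] at this
      nlinarith [mul_nonneg ht hω.le]
    exact (abs_sub _ _).trans (add_le_add (Real.abs_cos_le_one _) hs)

/-- Near the origin, the differentiated multiplier is a heat-type multiplier up to an
exponentially decaying remainder. -/
theorem abs_khatDt_le_of_norm_lt {n : ℕ} {t : ℝ} (ht : 0 ≤ t) {ξ : Rn n} (h : ‖ξ‖ < 1/4) :
    |KhatDt t ξ| ≤ 5/2 * (‖ξ‖^2 * Real.exp (-(t * ‖ξ‖^2))) + 2 * Real.exp (-(t / 2)) := by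
  have hr := norm_nonneg ξ
  rw [khatDt_of_norm_lt t (by linarith)]
  have hω : 2/5 ≤ √(1/4 - ‖ξ‖^2) := Real.le_sqrt_of_sq_le (by nlinarith)
  have hω' := sqrt_quarter_sub_sq_le ‖ξ‖ (by nlinarith)
  have hsq : √(1/4 - ‖ξ‖^2) ^ 2 = 1/4 - ‖ξ‖^2 := Real.sq_sqrt (by nlinarith)
  set ω := √(1/4 - ‖ξ‖^2)
  set r := ‖ξ‖
  have hω0 : 0 < ω := by linarith
  have ha : |1 - 1 / (2 * ω)| ≤ 5 * r^2 := by
    have h1 : 1 - 1 / (2 * ω) = -(1 - 2 * ω) / (2 * ω) := by field_simp; ring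
    rw [h1, abs_div, abs_neg, abs_of_nonneg (by nlinarith : 0 ≤ 1 - 2 * ω),
      abs_of_pos (by positivity), div_le_iff₀ (by positivity)]
    nlinarith [sq_nonneg r]
  have hb : |1 + 1 / (2 * ω)| ≤ 4 := by
    rw [abs_of_pos (by positivity)]
    have : 1 / (2 * ω) ≤ 3 := by rw [div_le_iff₀ (by positivity)]; linarith
    linarith
  have hsplit : Real.exp (-t/2) * (Real.cosh (t * ω) - Real.sinh (t * ω) / (2 * ω))
      = (1 - 1 / (2 * ω)) / 2 * Real.exp (-t/2 + t * ω)
        + (1 + 1 / (2 * ω)) / 2 * Real.exp (-t/2 + -(t * ω)) := by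
    rw [Real.cosh_eq, Real.sinh_eq, Real.exp_add, Real.exp_add]
    field_simp
    ring
  have he1 : Real.exp (-t/2 + t * ω) ≤ Real.exp (-(t * r^2)) :=
    Real.exp_le_exp.2 (by nlinarith [mul_le_mul_of_nonneg_left hω' ht])
  have he2 : Real.exp (-t/2 + -(t * ω)) ≤ Real.exp (-(t / 2)) :=
    Real.exp_le_exp.2 (by nlinarith [mul_nonneg ht hω0.le])
  rw [hsplit]
  refine (abs_add_le _ _).trans (add_le_add ?_ ?_)
  · rw [abs_mul, Real.abs_exp, abs_div, abs_two, ← mul_assoc]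
    exact mul_le_mul (by linarith) he1 (Real.exp_pos _).le (by positivity)
  · rw [abs_mul, Real.abs_exp, abs_div, abs_two]
    exact mul_le_mul (by linarith) he2 (Real.exp_pos _).le (by positivity)

theorem khatDt_sq_le_of_norm_lt {n : ℕ} {t : ℝ} (ht : 0 ≤ t) {ξ : Rn n} (h : ‖ξ‖ < 1/4) :
    KhatDt t ξ ^ 2 ≤ 40 * (‖ξ‖^4 * Real.exp (-(2 * (1 + t)) * ‖ξ‖^2)
      + Real.exp (-t) * Real.exp (-1 * ‖ξ‖^2)) := by
  have hr := norm_nonneg ξ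
  have hK := abs_khatDt_le_of_norm_lt ht h
  set r := ‖ξ‖
  have hr2 : r^2 ≤ 1/16 := by nlinarith
  have h3 : Real.exp (2 * r^2) ≤ 3 :=
    (Real.exp_le_exp.2 (by linarith)).trans Real.exp_one_lt_three.le
  have h3' : Real.exp (r^2) ≤ 3 :=
    (Real.exp_le_exp.2 (by linarith)).trans Real.exp_one_lt_three.le
  have e1 : Real.exp (-(t * r^2)) ^ 2
      = Real.exp (2 * r^2) * Real.exp (-(2 * (1 + t)) * r^2) := by
    rw [← Real.exp_nat_mul, ← Real.exp_add]; push_cast; ring_nf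
  have e2 : Real.exp (-(t / 2)) ^ 2 = Real.exp (-t) * (Real.exp (r^2) * Real.exp (-1 * r^2)) := by
    rw [← Real.exp_nat_mul, ← Real.exp_add, ← Real.exp_add]; push_cast; ring_nf
  calc KhatDt t ξ ^ 2 = |KhatDt t ξ| ^ 2 := (sq_abs _).symm
    _ ≤ (5/2 * (r^2 * Real.exp (-(t * r^2))) + 2 * Real.exp (-(t / 2))) ^ 2 := by gcongr
    _ ≤ 2 * ((5/2 * (r^2 * Real.exp (-(t * r^2))))^2 + (2 * Real.exp (-(t / 2)))^2) := add_sq_le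
    _ = 25/2 * (r^4 * (Real.exp (2 * r^2) * Real.exp (-(2 * (1 + t)) * r^2)))
        + 8 * (Real.exp (-t) * (Real.exp (r^2) * Real.exp (-1 * r^2))) := by
      rw [← e1, ← e2]; ring
    _ ≤ 25/2 * (r^4 * (3 * Real.exp (-(2 * (1 + t)) * r^2)))
        + 8 * (Real.exp (-t) * (3 * Real.exp (-1 * r^2))) := by gcongr
    _ ≤ _ := by
      have : 0 ≤ r^4 * Real.exp (-(2 * (1 + t)) * r^2) := by positivity
      have : 0 ≤ Real.exp (-t) * Real.exp (-1 * r^2) := by positivity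
      nlinarith

theorem exists_exp_neg_mul_le_rpow {c : ℝ} (hc : 0 < c) (a : ℝ) :
    ∃ C > (0:ℝ), ∀ t : ℝ, 0 ≤ t → Real.exp (-(c * t)) ≤ C * (1 + t) ^ a := by
  set b := max (-a) 1
  have hb : 0 < b := lt_max_of_lt_right one_pos
  set K := max 1 (b / c)
  have hK : 1 ≤ K := le_max_left _ _
  refine ⟨K ^ b, by positivity, fun t ht => ?_⟩
  have h1 : 1 + t ≤ K * Real.exp (c / b * t) := by
    have h2 : b / c ≤ K := le_max_right _ _
    have h3 := Real.add_one_le_exp (c / b * t)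
    have h4 : 1 ≤ K * (c / b) := by
      calc (1:ℝ) = b / c * (c / b) := by field_simp
        _ ≤ _ := by gcongr
    calc 1 + t ≤ K * (c / b * t + 1) := by nlinarith
      _ ≤ _ := by gcongr
  have h2 : (1 + t) ^ (-a) ≤ K ^ b * Real.exp (c * t) := by
    calc (1 + t) ^ (-a) ≤ (1 + t) ^ b :=
          Real.rpow_le_rpow_of_exponent_le (by linarith) (le_max_left _ _)
      _ ≤ (K * Real.exp (c / b * t)) ^ b := by gcongr
      _ = _ := by
        rw [Real.mul_rpow (by positivity) (by positivity), ← Real.exp_mul]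
        congr 2
        field_simp
  rw [Real.rpow_neg (by linarith), inv_le_iff_one_le_mul₀ (by positivity)] at h2
  rw [Real.exp_neg, inv_le_iff_one_le_mul₀ (by positivity)]
  linarith

theorem rpow_two_mul_le_of_quarter_le (s : ℝ) {r : ℝ} (hr : 1/4 ≤ r) :
    r ^ (2 * s) ≤ 17 ^ |s| * (1 + r^2) ^ s := by
  have h0 : 0 < r := by linarith
  rw [Real.rpow_mul h0.le, Real.rpow_two]
  rcases le_total 0 s with hs | hs
  · calc (r^2) ^ s ≤ 1 * (1 + r^2) ^ s := by rw [one_mul]; gcongr; linarith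
      _ ≤ _ := by gcongr; exact Real.one_le_rpow (by norm_num) (abs_nonneg s)
  · rw [abs_of_nonpos hs, Real.rpow_neg (by norm_num), inv_mul_eq_div,
      le_div_iff₀ (by positivity), ← Real.mul_rpow (by positivity) (by norm_num)]
    exact Real.rpow_le_rpow_of_nonpos (by positivity) (by nlinarith) hs

theorem exists_lintegral_norm_rpow_mul_exp_neg_mul_sq {n : ℕ} (hn : 1 ≤ n) {a : ℝ}
    (ha : -(n:ℝ) < a) :
    ∃ C > (0:ℝ), ∀ b : ℝ, 0 < b →
      ∫⁻ ξ : Rn n, ENNReal.ofReal (‖ξ‖ ^ a * Real.exp (-b * ‖ξ‖^2))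
        = ENNReal.ofReal (C * b ^ (-(a + n) / 2)) := by
  have : Nonempty (Fin n) := ⟨⟨0, hn⟩⟩
  have hdim : Module.finrank ℝ (Rn n) = n := by simp
  have hv : 0 < volume.real (Metric.ball (0 : Rn n) 1) :=
    ENNReal.toReal_pos (Metric.measure_ball_pos _ _ one_pos).ne' measure_ball_lt_top.ne
  have hg : 0 < Real.Gamma ((a + n) / 2) := Real.Gamma_pos_of_pos (by linarith)
  have hn0 : (0:ℝ) < n := by exact_mod_cast hn
  refine ⟨n * (volume.real (Metric.ball (0 : Rn n) 1) * (1/2 * Real.Gamma ((a + n) / 2))),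
    by positivity, fun b hb => ?_⟩
  have hradial : Set.EqOn (fun y : ℝ => y ^ (n - 1) • (y ^ a * Real.exp (-b * y^2)))
      (fun y => y ^ (a + n - 1) * Real.exp (-b * y ^ (2:ℝ))) (Set.Ioi 0) := fun y hy => by
    simp only [smul_eq_mul, Real.rpow_two]
    rw [← mul_assoc, ← Real.rpow_natCast, ← Real.rpow_add hy, Nat.cast_sub hn]
    congr 2
    push_cast
    ring
  have hint : Integrable fun ξ : Rn n => ‖ξ‖ ^ a * Real.exp (-b * ‖ξ‖^2) := by
    rw [integrable_fun_norm_addHaar volume (f := fun y => y ^ a * Real.exp (-b * y^2)), hdim,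
      integrableOn_congr_fun hradial measurableSet_Ioi]
    exact integrableOn_rpow_mul_exp_neg_mul_rpow (by linarith) two_pos hb
  rw [← ofReal_integral_eq_lintegral_ofReal hint (.of_forall fun ξ => by positivity),
    integral_fun_norm_addHaar volume (fun y => y ^ a * Real.exp (-b * y^2)), hdim,
    setIntegral_congr_fun measurableSet_Ioi hradial,
    integral_rpow_mul_exp_neg_mul_rpow two_pos (by linarith) hb]
  simp only [sub_add_cancel, nsmul_eq_mul, smul_eq_mul]
  ring_nf

theorem exists_lintegral_khatDt_majorant_le {n : ℕ} (hn : 1 ≤ n) {p : ℝ} (hp : -(n:ℝ) < p) :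
    ∃ C > (0:ℝ), ∀ t : ℝ, 0 ≤ t →
      ∫⁻ ξ : Rn n, ENNReal.ofReal (40 * (‖ξ‖ ^ (p + 4) * Real.exp (-(2 * (1 + t)) * ‖ξ‖^2)
        + Real.exp (-t) * (‖ξ‖ ^ p * Real.exp (-1 * ‖ξ‖^2))))
      ≤ ENNReal.ofReal (C * (1 + t) ^ (-(p + 4 + n) / 2)) := by
  obtain ⟨A, hA, hA'⟩ :=
    exists_lintegral_norm_rpow_mul_exp_neg_mul_sq hn (show -(n:ℝ) < p + 4 by linarith)
  obtain ⟨B, hB, hB'⟩ := exists_lintegral_norm_rpow_mul_exp_neg_mul_sq hn hp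
  obtain ⟨D, hD, hD'⟩ := exists_exp_neg_mul_le_rpow one_pos (-(p + 4 + n) / 2)
  refine ⟨40 * (A * 2 ^ (-(p + 4 + n) / 2) + D * B), by positivity, fun t ht => ?_⟩
  have hmeas : Measurable fun ξ : Rn n =>
      ENNReal.ofReal (‖ξ‖ ^ (p + 4) * Real.exp (-(2 * (1 + t)) * ‖ξ‖^2)) := by fun_prop
  have hmeas' : Measurable fun ξ : Rn n =>
      ENNReal.ofReal (‖ξ‖ ^ p * Real.exp (-1 * ‖ξ‖^2)) := by fun_prop
  have hsplit : ∀ ξ : Rn n,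
      ENNReal.ofReal (40 * (‖ξ‖ ^ (p + 4) * Real.exp (-(2 * (1 + t)) * ‖ξ‖^2)
        + Real.exp (-t) * (‖ξ‖ ^ p * Real.exp (-1 * ‖ξ‖^2))))
      = ENNReal.ofReal 40 *
        (ENNReal.ofReal (‖ξ‖ ^ (p + 4) * Real.exp (-(2 * (1 + t)) * ‖ξ‖^2))
          + ENNReal.ofReal (Real.exp (-t)) *
            ENNReal.ofReal (‖ξ‖ ^ p * Real.exp (-1 * ‖ξ‖^2))) := fun ξ => by
    rw [ENNReal.ofReal_mul (by norm_num), ENNReal.ofReal_add (by positivity) (by positivity),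
      ENNReal.ofReal_mul (Real.exp_pos _).le]
  simp_rw [hsplit]
  rw [lintegral_const_mul _ (by fun_prop), lintegral_add_left hmeas,
    lintegral_const_mul _ hmeas', hA' _ (by linarith), hB' 1 one_pos, Real.one_rpow, mul_one,
    ← ENNReal.ofReal_mul (Real.exp_pos _).le, ← ENNReal.ofReal_add (by positivity) (by positivity),
    ← ENNReal.ofReal_mul (by norm_num)]
  apply ENNReal.ofReal_le_ofReal
  rw [Real.mul_rpow (by norm_num) (by linarith)]
  have := hD' t ht
  rw [one_mul] at this
  nlinarith

theorem rpow_mul_khatDt_sq_mul_le_of_norm_lt {n : ℕ} {q s t x : ℝ} (ht : 0 ≤ t) {ξ : Rn n}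
    (hξ : ξ ≠ 0) (h : ‖ξ‖ < 1/4) :
    ‖ξ‖ ^ (2*s) * KhatDt t ξ ^ 2 * x^2
      ≤ 40 * (‖ξ‖ ^ (2*(s-q) + 4) * Real.exp (-(2 * (1 + t)) * ‖ξ‖^2)
        + Real.exp (-t) * (‖ξ‖ ^ (2*(s-q)) * Real.exp (-1 * ‖ξ‖^2))) * (‖ξ‖ ^ q * x)^2 := by
  have hr : 0 < ‖ξ‖ := norm_pos_iff.2 hξ
  have h1 : ‖ξ‖ ^ (2*s) = ‖ξ‖ ^ (2*(s-q)) * (‖ξ‖ ^ q)^2 := by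
    rw [← Real.rpow_natCast, ← Real.rpow_mul hr.le, ← Real.rpow_add hr]
    push_cast
    ring_nf
  have h2 : ‖ξ‖ ^ (2*(s-q) + 4) = ‖ξ‖ ^ (2*(s-q)) * ‖ξ‖^4 := by
    rw [Real.rpow_add hr]; norm_cast
  calc ‖ξ‖ ^ (2*s) * KhatDt t ξ ^ 2 * x^2
      = ‖ξ‖ ^ (2*(s-q)) * KhatDt t ξ ^ 2 * (‖ξ‖ ^ q * x)^2 := by rw [h1]; ring
    _ ≤ ‖ξ‖ ^ (2*(s-q)) * (40 * (‖ξ‖^4 * Real.exp (-(2 * (1 + t)) * ‖ξ‖^2)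
          + Real.exp (-t) * Real.exp (-1 * ‖ξ‖^2))) * (‖ξ‖ ^ q * x)^2 := by
      gcongr; exact khatDt_sq_le_of_norm_lt ht h
    _ = _ := by rw [h2]; ring

theorem exists_rpow_mul_khatDt_sq_mul_le_of_quarter_le (s e : ℝ) :
    ∃ C > (0:ℝ), ∀ (n : ℕ) (t x : ℝ) (ξ : Rn n), 0 ≤ t → 1/4 ≤ ‖ξ‖ →
      ‖ξ‖ ^ (2*s) * KhatDt t ξ ^ 2 * x^2
        ≤ C * (1 + t) ^ e * ((1 + ‖ξ‖^2) ^ s * x^2) := by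
  obtain ⟨C, hC, hC'⟩ := exists_exp_neg_mul_le_rpow (show (0:ℝ) < 1/8 by norm_num) (e - 2)
  refine ⟨17 ^ |s| * C, by positivity, fun n t x ξ ht h => ?_⟩
  have hK : KhatDt t ξ ^ 2 ≤ C * (1 + t) ^ e := by
    calc KhatDt t ξ ^ 2 = |KhatDt t ξ| ^ 2 := (sq_abs _).symm
      _ ≤ ((1 + t) * Real.exp (-(t / 16))) ^ 2 := by
        gcongr; exact abs_khatDt_le_of_quarter_le ht h
      _ = (1 + t)^2 * Real.exp (-(1/8 * t)) := by
        rw [mul_pow, ← Real.exp_nat_mul]; push_cast; ring_nf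
      _ ≤ (1 + t)^2 * (C * (1 + t) ^ (e - 2)) := by gcongr; exact hC' t ht
      _ = C * (1 + t) ^ e := by
        rw [Real.rpow_sub (by linarith), Real.rpow_two]
        field_simp
  calc ‖ξ‖ ^ (2*s) * KhatDt t ξ ^ 2 * x^2
      ≤ 17 ^ |s| * (1 + ‖ξ‖^2) ^ s * (C * (1 + t) ^ e) * x^2 := by
        gcongr; exact rpow_two_mul_le_of_quarter_le s h
    _ = _ := by ring

theorem exists_lintegral_khatDt_sq_le {n : ℕ} (hn : 1 ≤ n) {q s : ℝ}
    (hs : q - (n:ℝ)/2 < s) :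
    ∃ C > (0:ℝ), ∀ t : ℝ, 0 ≤ t → ∀ f : Rn n → ℂ, Measurable f →
      ∫⁻ ξ : Rn n, ENNReal.ofReal (‖ξ‖ ^ (2*s) * (KhatDt t ξ)^2 * ‖f ξ‖^2)
        ≤ ENNReal.ofReal (C * (1+t) ^ (2 * (-(n:ℝ)/4 - (s-q)/2 - 1))) *
          ((∫⁻ ξ : Rn n, ENNReal.ofReal ((1+‖ξ‖^2) ^ s * ‖f ξ‖^2))
            + (⨆ ξ : Rn n, ENNReal.ofReal (‖ξ‖ ^ q * ‖f ξ‖)) ^ 2) := by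
  have : Nonempty (Fin n) := ⟨⟨0, hn⟩⟩
  set e : ℝ := 2 * (-(n:ℝ)/4 - (s-q)/2 - 1) with he
  obtain ⟨A, hA, hA'⟩ :=
    exists_lintegral_khatDt_majorant_le hn (show -(n:ℝ) < 2*(s-q) by linarith)
  obtain ⟨B, hB, hB'⟩ := exists_rpow_mul_khatDt_sq_mul_le_of_quarter_le s e
  rw [show -(2*(s-q) + 4 + n) / 2 = e by rw [he]; ring] at hA'
  refine ⟨max A B, lt_max_of_lt_left hA, fun t ht f hf => ?_⟩
  set M := ⨆ ξ : Rn n, ENNReal.ofReal (‖ξ‖ ^ q * ‖f ξ‖)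
  set G : Rn n → ℝ := fun ξ =>
    40 * (‖ξ‖ ^ (2*(s-q) + 4) * Real.exp (-(2 * (1 + t)) * ‖ξ‖^2)
      + Real.exp (-t) * (‖ξ‖ ^ (2*(s-q)) * Real.exp (-1 * ‖ξ‖^2)))
  have hGm : Measurable fun ξ => ENNReal.ofReal (G ξ) := by fun_prop
  have hpt : ∀ᵐ ξ : Rn n, ENNReal.ofReal (‖ξ‖ ^ (2*s) * (KhatDt t ξ)^2 * ‖f ξ‖^2)
      ≤ ENNReal.ofReal (B * (1+t) ^ e) * ENNReal.ofReal ((1+‖ξ‖^2) ^ s * ‖f ξ‖^2)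
        + ENNReal.ofReal (G ξ) * M ^ 2 := by
    filter_upwards [Measure.ae_ne volume (0 : Rn n)] with ξ hξ
    rcases lt_or_ge ‖ξ‖ (1/4) with h | h
    · refine le_add_left ?_
      calc _ ≤ ENNReal.ofReal (G ξ * (‖ξ‖ ^ q * ‖f ξ‖)^2) :=
            ENNReal.ofReal_le_ofReal (rpow_mul_khatDt_sq_mul_le_of_norm_lt ht hξ h)
        _ = ENNReal.ofReal (G ξ) * ENNReal.ofReal (‖ξ‖ ^ q * ‖f ξ‖) ^ 2 := by
          rw [ENNReal.ofReal_mul (by positivity), ENNReal.ofReal_pow (by positivity)]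
        _ ≤ _ := by gcongr; exact le_iSup (fun ξ : Rn n => ENNReal.ofReal (‖ξ‖ ^ q * ‖f ξ‖)) ξ
    · refine le_add_right ?_
      rw [← ENNReal.ofReal_mul (by positivity)]
      exact ENNReal.ofReal_le_ofReal (hB' n t _ ξ ht h)
  refine (lintegral_mono_ae hpt).trans ?_
  rw [lintegral_add_left (by fun_prop), lintegral_const_mul _ (by fun_prop),
    lintegral_mul_const _ hGm, mul_add]
  gcongr
  · exact le_max_right _ _
  · refine (hA' t ht).trans (ENNReal.ofReal_le_ofReal ?_)
    gcongr
    exact le_max_left _ _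

theorem stmt_6 (n : ℕ) (hn : 1 ≤ n) (q s : ℝ) (hq0 : 0 ≤ q) (hq : q < (n:ℝ)/2)
    (hs : q - (n:ℝ)/2 < s) :
    ∃ C > (0:ℝ), ∀ t : ℝ, 0 ≤ t → ∀ f : Rn n → ℂ, Measurable f →
      (∫⁻ ξ : Rn n, ENNReal.ofReal (‖ξ‖ ^ (2*s) * (KhatDt t ξ)^2 * ‖f ξ‖^2)) ^ ((1:ℝ)/2)
        ≤ ENNReal.ofReal (C * (1+t) ^ (-(n:ℝ)/4 - (s-q)/2 - 1)) *
          ((∫⁻ ξ : Rn n, ENNReal.ofReal ((1+‖ξ‖^2) ^ s * ‖f ξ‖^2)) ^ ((1:ℝ)/2)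
            + ⨆ ξ : Rn n, ENNReal.ofReal (‖ξ‖ ^ q * ‖f ξ‖)) := by
  obtain ⟨C, hC, hC'⟩ := exists_lintegral_khatDt_sq_le hn hs
  refine ⟨√C, Real.sqrt_pos.2 hC, fun t ht f hf => ?_⟩
  have hsq : (√C * (1+t) ^ (-(n:ℝ)/4 - (s-q)/2 - 1)) ^ 2
      = C * (1+t) ^ (2 * (-(n:ℝ)/4 - (s-q)/2 - 1)) := by
    rw [mul_pow, Real.sq_sqrt hC.le, mul_comm (2:ℝ), Real.rpow_mul (by linarith), Real.rpow_two]
  have hroot : ∀ y : ℝ≥0∞, (y ^ 2) ^ ((1:ℝ)/2) = y := fun y => by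
    rw [← ENNReal.rpow_natCast, ← ENNReal.rpow_mul]
    norm_num
  refine (ENNReal.rpow_le_rpow (hC' t ht f hf) (by norm_num)).trans ?_
  rw [ENNReal.mul_rpow_of_nonneg _ _ (by norm_num), ← hsq, ENNReal.ofReal_pow (by positivity),
    hroot]
  gcongr
  refine (ENNReal.rpow_add_le_add_rpow _ _ (by norm_num) (by norm_num)).trans ?_
  rw [hroot]

end
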